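/- arXiv:2604.24207 — 8 statements merged into one kernel-verified Lean document; each statement's English description precedes it below -/
import Mathlib

section
/- Touchard's identity: for every natural number n, C_{n+1} = Σ_{k=0}^{⌊n/2⌋} binom(n, 2k) · 2^{n-2k} · C_k. -/
open Finset

open Polynomial in
/-- The Catalan number `C_k` is the `k`-th coefficient of `(1 + X) ^ (2 * k) * (1 - X)`. -/
theorem catalan_eq_coeff (k : ℕ) :
    (catalan k : ℤ) = ((1 + X : ℤ[X]) ^ (2 * k) * (1 - X)).coeff k := by
  have hcat : ((k : ℤ) + 1) * catalan k = (2 * k).choose k := by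
    exact_mod_cast succ_mul_catalan_eq_centralBinom k
  have hk : (k : ℤ) + 1 ≠ 0 := by positivity
  cases k with
  | zero => simp
  | succ m =>
    have hchoose : ((2 * (m + 1)).choose (m + 1) : ℤ) * (m + 1) =
        (2 * (m + 1)).choose m * (m + 2) := by
      have h := Nat.choose_succ_right_eq (2 * (m + 1)) m
      rw [show 2 * (m + 1) - m = m + 2 by omega] at h
      exact_mod_cast h
    rw [mul_sub, mul_one, coeff_sub, coeff_mul_X, coeff_one_add_X_pow, coeff_one_add_X_pow]
    apply mul_left_cancel₀ hk
    push_cast at hcat ⊢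
    linear_combination hcat - hchoose

open Polynomial in
/-- The Catalan number `C_{n+1}` is the `n`-th coefficient of `(1 + X) ^ (2 * n) * (1 - X ^ 2)`. -/
theorem catalan_succ_eq_coeff (n : ℕ) :
    (catalan (n + 1) : ℤ) = ((1 + X : ℤ[X]) ^ (2 * n) * (1 - X ^ 2)).coeff n := by
  rw [catalan_eq_coeff,
    show (1 + X : ℤ[X]) ^ (2 * n) * (1 - X ^ 2) = (1 + X) ^ (2 * n + 1) * (1 - X) by ring,
    mul_sub, mul_one, coeff_sub, coeff_mul_X, mul_sub, mul_one, coeff_sub]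
  cases n with
  | zero => simp [coeff_one_add_X_pow]
  | succ m =>
    simp only [coeff_mul_X, coeff_one_add_X_pow]
    have hsymm := Nat.choose_symm_half (m + 1)
    rw [show 2 * (m + 1 + 1) = 2 * (m + 1) + 1 + 1 by ring, Nat.choose_succ_succ _ (m + 1),
      Nat.choose_succ_succ (2 * (m + 1) + 1) m, hsymm]
    push_cast
    ring

open Polynomial in
theorem coeff_one_add_X_sq_pow_mul (j : ℕ) :
    ((1 + X ^ 2 : ℤ[X]) ^ j * (1 - X ^ 2)).coeff j =
      if Even j then (catalan (j / 2) : ℤ) else 0 := by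
  have hexpand : (1 + X ^ 2 : ℤ[X]) ^ j * (1 - X ^ 2) = expand ℤ 2 ((1 + X) ^ j * (1 - X)) := by
    simp
  rw [hexpand, coeff_expand two_pos]
  simp only [even_iff_two_dvd]
  split_ifs with h
  · obtain ⟨k, rfl⟩ := h
    rw [Nat.mul_div_cancel_left _ two_pos, catalan_eq_coeff]
  · rfl

open Polynomial in
theorem catalan_succ_eq_sum_even (n : ℕ) :
    catalan (n + 1) =
      ∑ j ∈ range (n + 1) with Even j, n.choose j * 2 ^ (n - j) * catalan (j / 2) := by
  zify
  rw [catalan_succ_eq_coeff, pow_mul,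
    show (1 + X : ℤ[X]) ^ 2 = (1 + X ^ 2) + 2 * X by ring, add_pow, sum_mul, finsetSum_coeff,
    sum_filter]
  refine sum_congr rfl fun j hj => ?_
  have hjn : j ≤ n := Nat.lt_succ_iff.mp (mem_range.mp hj)
  have hterm : (1 + X ^ 2 : ℤ[X]) ^ j * (2 * X) ^ (n - j) * (n.choose j : ℤ[X]) * (1 - X ^ 2) =
      C ((n.choose j : ℤ) * 2 ^ (n - j)) * ((1 + X ^ 2) ^ j * (1 - X ^ 2) * X ^ (n - j)) := by
    simp only [map_mul, map_pow, map_natCast, map_ofNat]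
    ring
  rw [hterm, coeff_C_mul, coeff_mul_X_pow', if_pos (Nat.sub_le n j), Nat.sub_sub_self hjn,
    coeff_one_add_X_sq_pow_mul]
  split_ifs <;> simp

/-- Touchard's identity: `C_{n+1} = ∑_{k=0}^{⌊n/2⌋} binom(n,2k)·2^{n-2k}·C_k`,
where `C_n` is the `n`-th Catalan number. -/
theorem touchard_identity (n : ℕ) :
    catalan (n + 1) =
      ∑ k ∈ Finset.range (n / 2 + 1), n.choose (2 * k) * 2 ^ (n - 2 * k) * catalan k := by
  rw [catalan_succ_eq_sum_even]
  refine sum_nbij' (· / 2) (2 * ·) ?_ ?_ ?_ ?_ ?_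
  · intro j hj
    simp only [mem_filter, mem_range] at hj ⊢
    omega
  · intro k hk
    simp only [mem_filter, mem_range, even_two_mul, and_true] at hk ⊢
    omega
  · intro j hj
    exact Nat.two_mul_div_two_of_even (mem_filter.mp hj).2
  · intro k _
    exact Nat.mul_div_cancel_left k two_pos
  · intro j hj
    rw [Nat.two_mul_div_two_of_even (mem_filter.mp hj).2]
end

section
/- Coker's identity: for every natural number n, the polynomial identity C_{n+1}(t) = Σ_{k=0}^{⌊n/2⌋} binom(n, 2k) · C_k · t^k · (1+t)^{n-2k} holds in ℤ[t], where C_k is the k-th Catalan number. -/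
open Polynomial Finset

/-- The Jacobi-type array: `a 0 k = [k = 0]`, and
`a (n+1) k = a n (k-1) + s k * a n k + t k * a n (k+1)` with `a n (-1) = 0`. -/
def jacobiA {R : Type*} [CommRing R] (s t : ℕ → R) : ℕ → ℕ → R
  | 0, k => if k = 0 then 1 else 0
  | n+1, k =>
      (if k = 0 then 0 else jacobiA s t n (k-1)) + s k * jacobiA s t n k
        + t k * jacobiA s t n (k+1)

/-- The Narayana polynomial `C_n(t) ∈ ℤ[t]`:
`C_0(t) = 1` and `C_n(t) = ∑_{k=0}^{n-1} (1/(k+1))·binom(n,k)·binom(n-1,k)·t^k` for `n ≥ 1`. -/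
noncomputable def narayana (n : ℕ) : Polynomial ℤ :=
  if n = 0 then 1 else
    ∑ k ∈ Finset.range n,
      Polynomial.C ((n.choose k * (n-1).choose k / (k+1) : ℕ) : ℤ) * Polynomial.X ^ k

/-- The polynomial `c_n(t) = C_n(t;-1) ∈ ℤ[t]`: `c_0(t) = 1` and
`c_n(t) = ∑_{k=0}^{n} binom(⌊(n-1)/2⌋,⌊k/2⌋)·binom(⌊n/2⌋,⌊(k+1)/2⌋)·t^k` for `n ≥ 1`. -/
noncomputable def cnar (n : ℕ) : Polynomial ℤ :=
  if n = 0 then 1 else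
    ∑ k ∈ Finset.range (n+1),
      Polynomial.C ((((n-1)/2).choose (k/2) * (n/2).choose ((k+1)/2) : ℕ) : ℤ) * Polynomial.X ^ k


/-- Writing `m = k + a` and `n = m + k + c`, the two ways of expanding a multinomial coefficient. -/
lemma succ_mul_choose_mul_catalan_mul_choose_add (k a c : ℕ) :
    (k + a + 1) * ((2 * k + (a + c)).choose (2 * k) * catalan k * (a + c).choose a) =
      ((k + a) + (k + c)).choose (k + a) * (((k + 1) + a).choose (k + 1) * (k + c).choose k) := by
  have hcat : (catalan k : ℚ) = (2 * k).factorial / (k.factorial * (k + 1).factorial) := by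
    have h : ((k : ℚ) + 1) * catalan k = (k + k).choose k := by
      rw [← two_mul]
      exact_mod_cast succ_mul_catalan_eq_centralBinom k
    rw [Nat.cast_add_choose, ← two_mul] at h
    have hk : (k : ℚ) + 1 ≠ 0 := by positivity
    rw [← mul_right_inj' hk, h, Nat.factorial_succ]
    push_cast
    field_simp
  rw [← Nat.cast_inj (R := ℚ)]
  push_cast
  rw [hcat]
  simp only [Nat.cast_add_choose]
  rw [show 2 * k + (a + c) = k + a + (k + c) by ring, show k + 1 + a = k + a + 1 by ring,
    Nat.factorial_succ (k + a)]
  push_cast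
  field_simp

lemma succ_mul_choose_mul_catalan_mul_choose {n m k : ℕ} (hkm : k ≤ m) :
    (m + 1) * (n.choose (2 * k) * catalan k * (n - 2 * k).choose (m - k)) =
      n.choose m * ((m + 1).choose (m - k) * (n - m).choose k) := by
  by_cases h : m + k ≤ n
  · obtain ⟨a, rfl⟩ := Nat.exists_eq_add_of_le hkm
    obtain ⟨c, rfl⟩ := Nat.exists_eq_add_of_le h
    have key := succ_mul_choose_mul_catalan_mul_choose_add k a c
    have hsymm : (k + a + 1).choose a = (k + 1 + a).choose (k + 1) := by
      rw [show k + a + 1 = k + 1 + a by ring, Nat.choose_symm_add]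
    rw [show k + a + k + c - 2 * k = a + c by omega, show k + a + k + c - (k + a) = k + c by omega,
      show k + a - k = a by omega, hsymm, show k + a + k + c = 2 * k + (a + c) by ring, key]
    congr 2
    ring
  · have hl : n.choose (2 * k) * (n - 2 * k).choose (m - k) = 0 := by
      rw [mul_eq_zero, Nat.choose_eq_zero_iff, Nat.choose_eq_zero_iff]
      omega
    have hr : n.choose m * (n - m).choose k = 0 := by
      rw [mul_eq_zero, Nat.choose_eq_zero_iff, Nat.choose_eq_zero_iff]
      omega
    linear_combination (m + 1) * catalan k * hl - (m + 1).choose (m - k) * hr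

lemma succ_mul_sum_choose_mul_catalan_mul_choose (n m : ℕ) :
    (m + 1) * ∑ k ∈ range (m + 1), n.choose (2 * k) * catalan k * (n - 2 * k).choose (m - k) =
      (n + 1).choose m * n.choose m := by
  rw [mul_sum, sum_congr rfl fun k hk =>
    succ_mul_choose_mul_catalan_mul_choose (n := n) (mem_range_succ_iff.mp hk), ← mul_sum]
  rcases le_or_gt m n with h | h
  · rw [show n + 1 = (n - m) + (m + 1) by omega, Nat.add_choose_eq,
      Nat.sum_antidiagonal_eq_sum_range_succ_mk, mul_comm]
    simp only [mul_comm]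
  · simp [Nat.choose_eq_zero_of_lt h]

lemma coeff_narayana_succ (n m : ℕ) :
    (narayana (n + 1)).coeff m =
      (((n + 1).choose m * n.choose m / (m + 1) : ℕ) : ℤ) := by
  rw [narayana, if_neg n.succ_ne_zero, finsetSum_coeff]
  simp only [coeff_C_mul_X_pow, Nat.add_sub_cancel]
  rw [sum_ite_eq, ite_eq_left_iff, mem_range, not_lt]
  intro h
  simp [Nat.choose_eq_zero_of_lt (show n < m by omega)]

/-- Coker's identity: `C_{n+1}(t) = ∑_{k=0}^{⌊n/2⌋} binom(n,2k)·C_k·t^k·(1+t)^{n-2k}` in `ℤ[t]`,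
where `C_k` is the `k`-th Catalan number. -/
theorem coker_identity (n : ℕ) :
    narayana (n + 1) =
      ∑ k ∈ Finset.range (n / 2 + 1),
        Polynomial.C ((n.choose (2 * k) * catalan k : ℕ) : ℤ) * Polynomial.X ^ k
          * (1 + Polynomial.X) ^ (n - 2 * k) := by
  ext m
  rw [coeff_narayana_succ, ← succ_mul_sum_choose_mul_catalan_mul_choose,
    Nat.mul_div_cancel_left _ m.succ_pos, finsetSum_coeff, Nat.cast_sum]
  have hcoeff (k : ℕ) : (C ((n.choose (2 * k) * catalan k : ℕ) : ℤ) * X ^ k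
      * (1 + X) ^ (n - 2 * k)).coeff m = if k ≤ m then
        ((n.choose (2 * k) * catalan k * (n - 2 * k).choose (m - k) : ℕ) : ℤ) else 0 := by
    rw [mul_assoc, coeff_C_mul, coeff_X_pow_mul', coeff_one_add_X_pow]
    split_ifs <;> simp
  simp only [hcoeff]
  rw [← sum_filter]
  symm
  refine sum_subset (fun k hk => ?_) fun k hk hk' => ?_
  · simp only [mem_filter, mem_range] at hk ⊢
    omega
  · simp only [mem_filter, mem_range] at hk hk'
    simp [Nat.choose_eq_zero_of_lt (show n < 2 * k by omega)]
end

section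
/- The Narayana polynomials satisfy the quadratic recursion coming from the functional equation C(t,z) = 1 + (1-t)·z·C(t,z) + t·z·C(t,z)²: for every n ≥ 0, C_{n+1}(t) = (1-t)·C_n(t) + t·Σ_{j=0}^{n} C_j(t)·C_{n-j}(t) as an identity in ℤ[t]. -/
open Polynomial Finset

/-- The integer form of the closed formula for the coefficients of `narayana n`. -/
theorem natCast_mul_coeff_narayana (n k : ℕ) :
    (n : ℤ) * (narayana n).coeff k = n.choose k * n.choose (k + 1) := by
  rcases n with _ | m
  · simp
  have hdvd : (k + 1) ∣ (m + 1).choose k * m.choose k := by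
    rcases k with _ | j
    · simp
    have h1 := Nat.add_one_mul_choose_eq m j
    have h2 := Nat.add_one_mul_choose_eq m (j + 1)
    rw [← Int.natCast_dvd_natCast]
    zify at h1 h2
    refine ⟨(m + 1).choose (j + 1) * m.choose (j + 1)
      - (m + 1).choose (j + 2) * m.choose j, ?_⟩
    push_cast
    linear_combination (m.choose (j + 1) : ℤ) * h1 - (m.choose j : ℤ) * h2
  have hcoeff : (narayana (m + 1)).coeff k
      = (((m + 1).choose k * m.choose k / (k + 1) : ℕ) : ℤ) := by
    simp only [narayana, Nat.succ_ne_zero, if_false, finsetSum_coeff, Polynomial.coeff_C_mul,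
      Polynomial.coeff_X_pow,
      Nat.add_sub_cancel, mul_ite, mul_one, mul_zero, Finset.sum_ite_eq, Finset.mem_range]
    split_ifs with h
    · rfl
    · rw [Nat.choose_eq_zero_of_lt (show m < k by omega)]
      simp
  obtain ⟨q, hq⟩ := hdvd
  rw [hcoeff, hq, Nat.mul_div_cancel_left _ k.succ_pos]
  have h1 := Nat.add_one_mul_choose_eq m k
  apply mul_left_cancel₀ (show ((k : ℤ) + 1) ≠ 0 by positivity)
  zify at hq h1
  push_cast
  linear_combination (-(m : ℤ) - 1) * hq + ((m + 1).choose k : ℤ) * h1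

/-- The absorption identity for consecutive binomial coefficients in a row. -/
theorem cast_succ_mul_choose_succ (m k : ℕ) :
    ((k : ℚ) + 1) * m.choose (k + 1) = (m - k) * m.choose k := by
  rcases le_or_gt k m with h | h
  · have := Nat.choose_succ_right_eq m k
    have h' : ((m.choose (k + 1) * (k + 1) : ℕ) : ℚ) = (m.choose k * (m - k) : ℕ) := by rw [this]
    push_cast [Nat.cast_sub h] at h'
    linarith
  · simp [Nat.choose_eq_zero_of_lt h, Nat.choose_eq_zero_of_lt (h.trans k.lt_succ_self)]

/-- The three-term recurrence for products of adjacent binomial coefficients in a row. -/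
theorem choose_mul_choose_three_term (m j : ℕ) :
    ((m : ℤ) + 3) * (m + 1) * ((m + 2).choose (j + 2) * (m + 2).choose (j + 3)) =
      (2 * m + 3) * (m + 2) * ((m + 1).choose (j + 2) * (m + 1).choose (j + 3)
          + (m + 1).choose (j + 1) * (m + 1).choose (j + 2))
        - (m + 1) * (m + 2) * (m.choose (j + 2) * m.choose (j + 3)
          - 2 * (m.choose (j + 1) * m.choose (j + 2)) + m.choose j * m.choose (j + 1)) := by
  have h1 := cast_succ_mul_choose_succ m j
  have h2 := cast_succ_mul_choose_succ m (j + 1)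
  have h3 := cast_succ_mul_choose_succ m (j + 2)
  simp only [Nat.choose_succ_succ' (m + 1), Nat.choose_succ_succ' m]
  generalize m.choose (j + 3) = x at *
  generalize m.choose (j + 2) = y at *
  generalize m.choose (j + 1) = z at *
  generalize m.choose j = w at *
  rw [← Int.cast_inj (α := ℚ)]
  push_cast at *
  have e1 : (z : ℚ) = (m - j) * w / (j + 1) := by
    rw [eq_div_iff (by positivity)]
    linarith
  have e2 : (y : ℚ) = (m - (j + 1)) * z / (j + 1 + 1) := by
    rw [eq_div_iff (by positivity)]
    linarith
  have e3 : (x : ℚ) = (m - (j + 2)) * y / (j + 2 + 1) := by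
    rw [eq_div_iff (by positivity)]
    linarith
  rw [e3, e2, e1]
  field_simp
  ring

/-- The three-term recurrence for the Narayana polynomials. -/
theorem narayana_three_term (m : ℕ) :
    ((m : ℤ[X]) + 3) * narayana (m + 2) =
      (2 * (m : ℤ[X]) + 3) * (1 + X) * narayana (m + 1) - (m : ℤ[X]) * (1 - X) ^ 2 * narayana m := by
  have hcoeff (k : ℕ) := natCast_mul_coeff_narayana m k
  have hcoeff' (k : ℕ) := natCast_mul_coeff_narayana (m + 1) k
  have hcoeff'' (k : ℕ) := natCast_mul_coeff_narayana (m + 2) k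
  suffices h : Polynomial.C ((m : ℤ) + 3) * narayana (m + 2) =
      Polynomial.C (2 * (m : ℤ) + 3) * (narayana (m + 1) + X * narayana (m + 1))
        - Polynomial.C (m : ℤ) * (narayana m
          - Polynomial.C 2 * (X * narayana m) + X * (X * narayana m)) by
    simp only [map_add, map_mul, map_natCast, map_ofNat] at h
    linear_combination h
  ext k
  have hm : ((m : ℤ) + 1) * (m + 2) ≠ 0 := by positivity
  apply mul_left_cancel₀ hm
  rcases k with _ | _ | j
  · have h0 := hcoeff 0
    have h1 := hcoeff' 0
    have h2 := hcoeff'' 0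
    simp at h0 h1 h2
    simp [-mul_eq_mul_left_iff]
    linear_combination ((m : ℤ) + 3) * (m + 1) * h2 - (2 * m + 3) * (m + 2) * h1
      + (m + 1) * (m + 2) * h0
  · have h00 := hcoeff 0
    have h01 := hcoeff 1
    have h10 := hcoeff' 0
    have h11 := hcoeff' 1
    have h21 := hcoeff'' 1
    simp only [Nat.choose_succ_succ' (m + 1), Nat.choose_succ_succ' m, Nat.choose_zero_right,
      Nat.choose_one_right, zero_add, Nat.reduceAdd] at h00 h01 h10 h11 h21
    push_cast at h00 h01 h10 h11 h21
    simp only [coeff_sub, coeff_add, Polynomial.coeff_C_mul, Polynomial.coeff_X_mul,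
      Polynomial.coeff_X_mul_zero, zero_add]
    linear_combination ((m : ℤ) + 3) * (m + 1) * h21 - (2 * m + 3) * (m + 2) * (h11 + h10)
      + (m + 1) * (m + 2) * (h01 - 2 * h00)
  · have hid := choose_mul_choose_three_term m j
    simp only [coeff_sub, coeff_add, Polynomial.coeff_C_mul, Polynomial.coeff_X_mul]
    have h0 := hcoeff j
    have h1 := hcoeff (j + 1)
    have h2 := hcoeff (j + 2)
    have h3 := hcoeff' (j + 1)
    have h4 := hcoeff' (j + 2)
    have h5 := hcoeff'' (j + 2)
    push_cast at h0 h1 h2 h3 h4 h5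
    linear_combination ((m : ℤ) + 3) * (m + 1) * h5 - (2 * m + 3) * (m + 2) * (h4 + h3)
      + (m + 1) * (m + 2) * (h2 - 2 * h1 + h0) + hid

open PowerSeries in
/-- A power series with constant coefficient one is determined by its logarithmic derivative. -/
theorem eq_of_mul_derivative_eq {R : Type*} [CommRing R] [IsDomain R] [CharZero R]
    {D W : PowerSeries R} (hD : constantCoeff D = 1) (hW : constantCoeff W = 1)
    (h : D * d⁄dX R W = d⁄dX R D * W) : W = D := by
  have hV : D * invOfUnit D 1 = 1 := mul_invOfUnit D 1 (by simp [hD])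
  set V := invOfUnit D 1
  have hD0 : D ≠ 0 := fun h0 => by simp [h0] at hD
  have hdV : D * d⁄dX R V + V * d⁄dX R D = 0 := by
    have := congrArg (d⁄dX R) hV
    simpa [Derivation.leibniz] using this
  have hWV : W * V = 1 := by
    apply PowerSeries.derivative.ext
    · have : D * d⁄dX R (W * V) = 0 := by
        simp only [Derivation.leibniz, smul_eq_mul]
        linear_combination W * hdV + V * h
      simpa [hD0] using this
    · have := congrArg PowerSeries.constantCoeff hV
      simp only [map_mul, hD, one_mul] at this
      simp [hW, this]
  linear_combination D * hWV - W * hV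

open PowerSeries in
/-- A power series with half the logarithmic derivative of `D` is a square root of `D`. -/
theorem sq_eq_of_mul_derivative_eq {R : Type*} [CommRing R] [IsDomain R] [CharZero R]
    {D H : PowerSeries R} (hD : PowerSeries.constantCoeff D = 1)
    (hH : PowerSeries.constantCoeff H ^ 2 = 1)
    (h : 2 * (D * d⁄dX R H) = d⁄dX R D * H) : H ^ 2 = D := by
  apply eq_of_mul_derivative_eq hD (by rw [map_pow, hH])
  rw [pow_two, Derivation.leibniz]
  simp only [smul_eq_mul]
  linear_combination H * h

open PowerSeries in
/-- The functional equation of the generating function of the Narayana polynomials. -/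
theorem narayana_functional_equation :
    PowerSeries.mk narayana = 1
      + PowerSeries.C (1 - Polynomial.X) * PowerSeries.X * PowerSeries.mk narayana
      + PowerSeries.C Polynomial.X * PowerSeries.X * PowerSeries.mk narayana ^ 2 := by
  set F : PowerSeries ℤ[X] := PowerSeries.mk narayana with hF
  set t : PowerSeries ℤ[X] := PowerSeries.C Polynomial.X with ht
  set z : PowerSeries ℤ[X] := PowerSeries.X with hz
  have hdz : d⁄dX ℤ[X] z = 1 := derivative_X
  have hdt : d⁄dX ℤ[X] t = 0 := derivative_C
  have hd2 : d⁄dX ℤ[X] (2 : PowerSeries ℤ[X]) = 0 := by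
    rw [← map_ofNat PowerSeries.C 2]
    exact PowerSeries.derivative_C
  have hct : PowerSeries.C (1 - Polynomial.X : ℤ[X]) = 1 - t := by simp [ht]
  have hrec : z * (1 - 2 * (1 + t) * z + (1 - t) ^ 2 * z ^ 2) * d⁄dX ℤ[X] F
      = (-1 + (1 + t) * z) * F + (1 + (1 - t) * z) := by
    have hL : z * (1 - 2 * (1 + t) * z + (1 - t) ^ 2 * z ^ 2) * d⁄dX ℤ[X] F
        = z * d⁄dX ℤ[X] F
          - PowerSeries.C (2 * (1 + Polynomial.X)) * (z * (z * d⁄dX ℤ[X] F))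
          + PowerSeries.C ((1 - Polynomial.X) ^ 2) * (z * (z * (z * d⁄dX ℤ[X] F))) := by
      simp only [map_mul, map_add, map_sub, map_pow, map_one, map_ofNat, ← ht]
      ring
    have hR : (-1 + (1 + t) * z) * F + (1 + (1 - t) * z)
        = - F + PowerSeries.C (1 + Polynomial.X) * (z * F)
          + (1 + PowerSeries.C (1 - Polynomial.X) * z) := by
      simp only [map_add, map_sub, map_one, ← ht]
      ring
    rw [hL, hR]
    ext1 n
    rcases n with _ | _ | m
    · simp [hz, hF, narayana]
    · simp only [hz, hF, LinearMap.map_add, LinearMap.map_sub, LinearMap.map_neg,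
        PowerSeries.coeff_C_mul,
        PowerSeries.coeff_succ_X_mul, PowerSeries.coeff_derivative, PowerSeries.coeff_mk,
        PowerSeries.coeff_one, PowerSeries.coeff_X]
      simp [narayana]
    · have := narayana_three_term m
      simp only [hz, hF, LinearMap.map_add, LinearMap.map_sub, LinearMap.map_neg,
        PowerSeries.coeff_C_mul,
        PowerSeries.coeff_succ_X_mul, PowerSeries.coeff_derivative, PowerSeries.coeff_mk,
        PowerSeries.coeff_one, PowerSeries.coeff_X]
      rcases m with _ | m
      · simp at this ⊢
        linear_combination this
      · simp [PowerSeries.coeff_succ_X_mul, PowerSeries.coeff_derivative] at this ⊢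
        linear_combination this
  set H : PowerSeries ℤ[X] := 2 * t * z * F - (1 - (1 - t) * z) with hH
  set D : PowerSeries ℤ[X] := 1 - 2 * (1 + t) * z + (1 - t) ^ 2 * z ^ 2 with hD
  have hsq : H ^ 2 = D := by
    apply sq_eq_of_mul_derivative_eq
    · simp [hD, hz]
    · simp [hH, hz]
    · have hdD : d⁄dX ℤ[X] D = - 2 * (1 + t) + 2 * (1 - t) ^ 2 * z := by
        simp [hD, pow_two, Derivation.leibniz, hdz, hdt, hd2]
        ring
      have hdH : d⁄dX ℤ[X] H = 2 * t * F + 2 * t * z * d⁄dX ℤ[X] F + (1 - t) := by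
        simp [hH, Derivation.leibniz, hdz, hdt, hd2]
        ring
      rw [hdD, hdH, hH]
      linear_combination 4 * t * hrec
  have ht0 : t ≠ 0 := fun h =>
    Polynomial.X_ne_zero (PowerSeries.C_injective (h.trans (map_zero _).symm))
  have hz0 : z ≠ 0 := PowerSeries.X_ne_zero
  rw [hct]
  have h4 : (4 : PowerSeries ℤ[X]) ≠ 0 := by
    intro h
    have := congrArg PowerSeries.constantCoeff h
    simp only [map_ofNat, map_zero] at this
    exact OfNat.ofNat_ne_zero 4 this
  apply mul_left_cancel₀ (mul_ne_zero (mul_ne_zero h4 ht0) hz0)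
  linear_combination -hsq

/-- The quadratic recursion for the Narayana polynomials coming from
`C(t,z) = 1 + (1-t)z C(t,z) + t z C(t,z)²`:
`C_{n+1}(t) = (1-t)·C_n(t) + t·∑_{j=0}^n C_j(t)·C_{n-j}(t)` in `ℤ[t]`. -/
theorem narayana_quadratic_recursion (n : ℕ) :
    narayana (n + 1) =
      (1 - Polynomial.X) * narayana n
        + Polynomial.X * ∑ j ∈ Finset.range (n + 1), narayana j * narayana (n - j) := by
  have h := congrArg (PowerSeries.coeff (n + 1)) narayana_functional_equation
  simp only [mul_assoc, map_add, PowerSeries.coeff_C_mul, PowerSeries.coeff_succ_X_mul,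
    PowerSeries.coeff_mk, PowerSeries.coeff_one, Nat.succ_ne_zero, if_false, zero_add] at h
  simp only [pow_two, PowerSeries.coeff_mul, PowerSeries.coeff_mk,
    Finset.Nat.sum_antidiagonal_eq_sum_range_succ_mk] at h
  exact h
end

section
/- With the constant weight sequences s_k = 1+t and t_k = t (in ℤ[t]), the Jacobi-type array satisfies a(n,0) = C_{n+1}(t) for all n ≥ 0; i.e., the generating function Σ_{n≥0} C_{n+1}(t) z^n has the Jacobi continued fraction expansion with s_n = 1+t and t_n = t. -/
open Polynomial Finset

theorem choose_succ_mul_succ_int (n k : ℕ) :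
    (n.choose (k + 1) : ℤ) * (k + 1) = n.choose k * (n - k) := by
  rcases le_or_gt k n with h | h
  · have := Nat.choose_succ_right_eq n k
    zify [h] at this
    exact this
  · simp [Nat.choose_eq_zero_of_lt h, Nat.choose_eq_zero_of_lt (Nat.lt_succ_of_lt h)]

/-- Reflection-principle formula for the coefficients of the array with weights `1 + t`, `t`. -/
theorem coeff_jacobiA_one_add_X (n k j : ℕ) :
    (jacobiA (fun _ => 1 + X) (fun _ => (X : ℤ[X])) n k).coeff j =
      n.choose (k + j) * n.choose j
        - n.choose (k + j + 1) * (if j = 0 then 0 else n.choose (j - 1) : ℕ) := by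
  induction n generalizing k j with
  | zero => rcases k with _ | k <;> rcases j with _ | j <;> simp [jacobiA, coeff_one]
  | succ n ih =>
    rcases k with _ | k <;> rcases j with _ | _ | j <;>
      simp [jacobiA, add_mul, ih, Nat.choose_succ_succ, ← add_assoc, add_right_comm _ 1] <;> ring

theorem choose_mul_choose_div_succ (n j : ℕ) :
    (((n + 1).choose j * n.choose j / (j + 1) : ℕ) : ℤ) =
      n.choose j * n.choose j
        - n.choose (j + 1) * (if j = 0 then 0 else n.choose (j - 1) : ℕ) := by
  push_cast
  apply Int.ediv_eq_of_eq_mul_right (by positivity)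
  rcases j with _ | m
  · simp
  · have h₁ := choose_succ_mul_succ_int n m
    have h₂ := choose_succ_mul_succ_int n (m + 1)
    simp only [Nat.choose_succ_succ n m, Nat.add_sub_cancel, Nat.succ_ne_zero, if_false]
    push_cast at h₂ ⊢
    linear_combination (-n.choose (m + 1) : ℤ) * h₁ + (n.choose m : ℤ) * h₂

/-- With constant weights `s_k = 1 + t`, `t_k = t` in `ℤ[t]`, the Jacobi-type array
satisfies `a(n,0) = C_{n+1}(t)`, the `(n+1)`-st Narayana polynomial. -/
theorem jacobi_narayana_shifted (n : ℕ) :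
    jacobiA (fun _ => 1 + Polynomial.X) (fun _ => Polynomial.X) n 0 = narayana (n + 1) := by
  ext j
  rw [coeff_jacobiA_one_add_X, zero_add, ← choose_mul_choose_div_succ, narayana,
    if_neg n.succ_ne_zero, finsetSum_coeff]
  simp only [coeff_C_mul_X_pow, Finset.sum_ite_eq, Finset.mem_range, Nat.add_sub_cancel]
  split_ifs with h
  · rfl
  · simp [Nat.choose_eq_zero_of_lt (show n < j by omega)]
end

section
/- With the weight sequences s_0 = 1, s_k = 1+t for k ≥ 1, and t_k = t for all k (in ℤ[t]), the Jacobi-type array satisfies a(n,0) = C_n(t) for all n ≥ 0; i.e., the generating function Σ_{n≥0} C_n(t) z^n has the Jacobi continued fraction expansion with s_0 = 1, s_n = 1+t for n > 0, and t_n = t. -/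
open Polynomial Finset

/-- The coefficient of `t ^ j` in the entry `(n + 1, k)` of the Jacobi-type array with weights
`s_0 = 1`, `s_k = 1 + t` for `k ≥ 1` and `t_k = t`. -/
def jacobiCoeff (n k : ℕ) : ℕ → ℤ
  | 0 => (n + 1).choose k
  | j + 1 => (n + 1).choose (j + 1) * (n + 1).choose (j + k + 1)
      - n.choose j * (n + 2).choose (j + k + 2)

theorem coeff_jacobiA_succ (n k j : ℕ) :
    (jacobiA (fun k => if k = 0 then (1 : ℤ[X]) else 1 + X) (fun _ => X) (n + 1) k).coeff j
      = jacobiCoeff n k j := by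
  induction n generalizing k j with
  | zero =>
    rcases k with _ | _ | k <;> rcases j with _ | _ | j <;>
      simp [jacobiA, jacobiCoeff, coeff_one, Nat.choose_eq_zero_of_lt]
  | succ n ih =>
    rw [jacobiA]
    rcases k with _ | k <;> rcases j with _ | _ | j <;>
      simp only [if_true, Nat.add_one_ne_zero, if_false, Nat.add_sub_cancel, coeff_add, one_mul,
        add_mul, coeff_X_mul, coeff_X_mul_zero, ih, zero_add, add_zero] <;>
      simp only [jacobiCoeff, Nat.choose_succ_succ, Nat.choose_zero_right, Nat.succ_eq_add_one,
        ← add_assoc, add_right_comm _ 1, zero_add, add_zero] <;>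
      push_cast <;> ring

theorem succ_mul_jacobiCoeff_zero (n j : ℕ) :
    ((j : ℤ) + 1) * jacobiCoeff n 0 j = (n + 1).choose j * n.choose j := by
  rcases j with _ | j
  · simp [jacobiCoeff]
  · have h₁ : ((n : ℤ) + 2) * (n + 1).choose (j + 1) = (n + 2).choose (j + 2) * (j + 2) := by
      exact_mod_cast Nat.add_one_mul_choose_eq (n + 1) (j + 1)
    have h₂ : ((n : ℤ) + 1) * n.choose j = (n + 1).choose (j + 1) * (j + 1) := by
      exact_mod_cast Nat.add_one_mul_choose_eq n j
    have h₃ : ((n + 1).choose (j + 1) : ℤ) = n.choose j + n.choose (j + 1) := by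
      exact_mod_cast Nat.choose_succ_succ n j
    simp only [jacobiCoeff, add_zero]
    push_cast
    linear_combination (n.choose j : ℤ) * h₁ - ((n + 1).choose (j + 1) : ℤ) * h₂
      + ((n + 1).choose (j + 1) : ℤ) * h₃

theorem coeff_narayana_succ_s8 (n j : ℕ) :
    (narayana (n + 1)).coeff j = jacobiCoeff n 0 j := by
  have h := succ_mul_jacobiCoeff_zero n j
  have hdiv : (((n + 1).choose j * n.choose j / (j + 1) : ℕ) : ℤ) = jacobiCoeff n 0 j := by
    push_cast
    rw [← h]
    exact Int.mul_ediv_cancel_left _ (by positivity)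
  rw [← hdiv, narayana, if_neg n.succ_ne_zero]
  simp only [finsetSum_coeff, coeff_C_mul, coeff_X_pow, mul_ite, mul_one, mul_zero,
    Finset.sum_ite_eq, Finset.mem_range, Nat.add_sub_cancel]
  split_ifs with hj
  · rfl
  · simp [Nat.choose_eq_zero_of_lt (show n < j by omega)]

/-- With weights `s_0 = 1`, `s_k = 1 + t` for `k ≥ 1`, `t_k = t` in `ℤ[t]`, the Jacobi-type
array satisfies `a(n,0) = C_n(t)`, the `n`-th Narayana polynomial. -/
theorem jacobi_narayana (n : ℕ) :
    jacobiA (fun k => if k = 0 then 1 else 1 + Polynomial.X)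
        (fun _ => Polynomial.X) n 0 = narayana n := by
  rcases n with _ | n
  · simp [jacobiA, narayana]
  · ext j
    rw [coeff_jacobiA_succ, coeff_narayana_succ_s8]
end

section
/- In the ring of formal power series in z over ℚ[t], with g(z) = Σ_{n≥0} c_{n+1}(t)·z^n, one has g(z)·g(-z) = Σ_{n≥0} C_{n+1}(t²)·z^{2n}; equivalently, for every n ≥ 0, Σ_{j=0}^{n} (-1)^j·c_{j+1}(t)·c_{n-j+1}(t) equals C_{n/2+1}(t²) if n is even and 0 if n is odd. -/
open Polynomial Finset

/-- `c_n(t)` as a polynomial over `ℚ`. -/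
noncomputable def cnarQ (n : ℕ) : Polynomial ℚ := (cnar n).map (Int.castRingHom ℚ)

/-- `C_n(t²) ∈ ℚ[t]`: the Narayana polynomial with `t` replaced by `t²`, over `ℚ`. -/
noncomputable def narayanaSqQ (n : ℕ) : Polynomial ℚ :=
  ((narayana n).comp (Polynomial.X ^ 2)).map (Int.castRingHom ℚ)

section ShiftedBinomialSums

variable {R : Type*} [CommRing R]

/-- The coefficient of `u ^ j` in the Laurent polynomial `(1 + u) ^ m * (1 + x / u) ^ m`. -/
def shiftedBinomSum (x : R) (m j : ℕ) : R :=
  ∑ i ∈ range (m + 1), (m.choose i * m.choose (i + j) : R) * x ^ i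

theorem shiftedBinomSum_eq_add_sum_succ (x : R) (m j : ℕ) :
    shiftedBinomSum x m j = m.choose j +
      ∑ i ∈ range (m + 1), (m.choose (i + 1) * m.choose (i + 1 + j) : R) * x ^ (i + 1) := by
  rw [shiftedBinomSum, sum_range_succ', sum_range_succ _ m]
  simp [add_comm]

@[simp]
theorem shiftedBinomSum_zero_zero (x : R) : shiftedBinomSum x 0 0 = 1 := by
  simp [shiftedBinomSum]

@[simp]
theorem shiftedBinomSum_zero_succ (x : R) (j : ℕ) : shiftedBinomSum x 0 (j + 1) = 0 := by
  simp [shiftedBinomSum]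

theorem shiftedBinomSum_succ_zero (x : R) (m : ℕ) :
    shiftedBinomSum x (m + 1) 0 =
      (1 + x) * shiftedBinomSum x m 0 + 2 * x * shiftedBinomSum x m 1 := by
  rw [one_add_mul]
  nth_rewrite 2 [shiftedBinomSum_eq_add_sum_succ]
  rw [shiftedBinomSum, sum_range_succ']
  simp only [shiftedBinomSum, mul_sum, add_assoc, ← sum_add_distrib]
  simp only [Nat.choose_succ_succ', Nat.choose_zero_right, Nat.cast_add, add_zero]
  rw [add_comm]
  simp only [Nat.cast_one, pow_zero, mul_one, add_right_inj]
  refine sum_congr rfl fun i _ => ?_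
  ring

theorem shiftedBinomSum_succ_succ (x : R) (m j : ℕ) :
    shiftedBinomSum x (m + 1) (j + 1) =
      shiftedBinomSum x m j + (1 + x) * shiftedBinomSum x m (j + 1)
        + x * shiftedBinomSum x m (j + 2) := by
  have key : shiftedBinomSum x (m + 1) (j + 1) = (m + 1).choose (j + 1) +
      ((∑ i ∈ range (m + 1), (m.choose (i + 1) * m.choose (i + 1 + j) : R) * x ^ (i + 1)) +
      (∑ i ∈ range (m + 1), (m.choose (i + 1) * m.choose (i + 1 + (j + 1)) : R) * x ^ (i + 1)) +
      x * shiftedBinomSum x m (j + 1) + x * shiftedBinomSum x m (j + 2)) := by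
    rw [shiftedBinomSum, sum_range_succ']
    simp only [shiftedBinomSum, mul_sum, ← sum_add_distrib]
    rw [add_comm]
    simp only [Nat.choose_zero_right, Nat.cast_one, pow_zero, mul_one, one_mul, zero_add,
      add_right_inj]
    refine sum_congr rfl fun i _ => ?_
    rw [← add_assoc (i + 1) j 1, Nat.choose_succ_succ' m i, Nat.choose_succ_succ' m (i + 1 + j),
      show i + (j + 1) = i + 1 + j by ring, show i + (j + 2) = i + 1 + j + 1 by ring]
    push_cast
    ring
  rw [key, one_add_mul, shiftedBinomSum_eq_add_sum_succ x m j]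
  have h := shiftedBinomSum_eq_add_sum_succ x m (j + 1)
  rw [Nat.choose_succ_succ']
  push_cast
  linear_combination -h

theorem sum_choose_mul_succ_choose (x : R) (m : ℕ) :
    ∑ i ∈ range (m + 1), (m.choose i * (m + 1).choose i : R) * x ^ i =
      shiftedBinomSum x m 0 + x * shiftedBinomSum x m 1 := by
  rw [shiftedBinomSum_eq_add_sum_succ x m 0, shiftedBinomSum, mul_sum, add_assoc,
    ← sum_add_distrib, sum_range_succ', sum_range_succ _ m]
  simp only [Nat.choose_succ_succ', Nat.choose_succ_self, Nat.choose_zero_right, Nat.cast_add,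
    Nat.cast_one, Nat.cast_zero, add_zero, zero_mul, mul_zero, pow_zero, mul_one]
  rw [add_comm, add_right_inj]
  refine sum_congr rfl fun i _ => ?_
  ring

theorem sum_choose_mul_succ_choose_succ (x : R) (m : ℕ) :
    ∑ i ∈ range (m + 1), (m.choose i * (m + 1).choose (i + 1) : R) * x ^ i =
      shiftedBinomSum x m 0 + shiftedBinomSum x m 1 := by
  simp only [shiftedBinomSum, ← sum_add_distrib, Nat.choose_succ_succ', Nat.cast_add, add_zero]
  refine sum_congr rfl fun i _ => ?_
  ring

end ShiftedBinomialSums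

section NarayanaSeries

variable {R : Type*} [CommRing R]

/-- The coefficients of the power series `M` with `M = z * (1 + M) * (1 + x * M)`. -/
def narayanaCoeff (x : R) : ℕ → R
  | 0 => 0
  | n + 1 => ∑ i : Fin (n + 1),
      ((if (i : ℕ) = 0 then 1 else 0) + narayanaCoeff x i) *
        ((if n - i = 0 then 1 else 0) + x * narayanaCoeff x (n - i))

/-- The power series `M` with `M = z * (1 + M) * (1 + x * M)`. -/
def narayanaSeries (x : R) : PowerSeries R := PowerSeries.mk (narayanaCoeff x)

theorem constantCoeff_narayanaSeries (x : R) :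
    PowerSeries.constantCoeff (narayanaSeries x) = 0 := by
  rw [← PowerSeries.coeff_zero_eq_constantCoeff_apply, narayanaSeries, PowerSeries.coeff_mk,
    narayanaCoeff]

theorem narayanaSeries_eq (x : R) :
    narayanaSeries x =
      PowerSeries.X * ((1 + narayanaSeries x) * (1 + PowerSeries.C x * narayanaSeries x)) := by
  ext n
  cases n with
  | zero => simp [constantCoeff_narayanaSeries]
  | succ n =>
    rw [PowerSeries.coeff_succ_X_mul, PowerSeries.coeff_mul,
      Nat.sum_antidiagonal_eq_sum_range_succ_mk, narayanaSeries, PowerSeries.coeff_mk,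
      narayanaCoeff, ← Fin.sum_univ_eq_sum_range
        (fun i => PowerSeries.coeff i (1 + PowerSeries.mk (narayanaCoeff x)) *
          PowerSeries.coeff (n - i) (1 + PowerSeries.C x * PowerSeries.mk (narayanaCoeff x)))]
    simp [PowerSeries.coeff_one]

/-- The generating function of the central sums `shiftedBinomSum x m 0`. -/
noncomputable def centralSeries (x : R) : PowerSeries R :=
  PowerSeries.invOfUnit (1 - PowerSeries.X *
    (1 + PowerSeries.C x + 2 * PowerSeries.C x * narayanaSeries x)) 1

theorem centralSeries_mul (x : R) :
    centralSeries x * (1 - PowerSeries.X *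
      (1 + PowerSeries.C x + 2 * PowerSeries.C x * narayanaSeries x)) = 1 :=
  PowerSeries.invOfUnit_mul _ _ (by simp)

theorem coeff_centralSeries_mul_pow (x : R) (m j : ℕ) :
    PowerSeries.coeff m (centralSeries x * narayanaSeries x ^ j) = shiftedBinomSum x m j := by
  have h₀ : centralSeries x = 1 + PowerSeries.X * (PowerSeries.C (1 + x) * centralSeries x +
      PowerSeries.C (2 * x) * (centralSeries x * narayanaSeries x ^ 1)) := by
    simp only [map_add, map_mul, map_one, map_ofNat]
    linear_combination centralSeries_mul x
  have h₁ (j : ℕ) : centralSeries x * narayanaSeries x ^ (j + 1) =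
      PowerSeries.X * (centralSeries x * narayanaSeries x ^ j +
        PowerSeries.C (1 + x) * (centralSeries x * narayanaSeries x ^ (j + 1)) +
        PowerSeries.C x * (centralSeries x * narayanaSeries x ^ (j + 2))) := by
    simp only [map_add, map_one]
    linear_combination centralSeries x * narayanaSeries x ^ j * narayanaSeries_eq x
  induction m generalizing j with
  | zero =>
    cases j with
    | zero => rw [pow_zero, mul_one, h₀]; simp
    | succ j => rw [h₁]; simp
  | succ m ih =>
    cases j with
    | zero =>
      rw [pow_zero, mul_one, h₀, map_add, PowerSeries.coeff_succ_X_mul, map_add,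
        PowerSeries.coeff_C_mul, PowerSeries.coeff_C_mul, ih, shiftedBinomSum_succ_zero, ← ih 0]
      simp [PowerSeries.coeff_one]
    | succ j =>
      rw [h₁, PowerSeries.coeff_succ_X_mul, map_add, map_add, PowerSeries.coeff_C_mul,
        PowerSeries.coeff_C_mul, ih, ih, ih, shiftedBinomSum_succ_succ]

theorem centralSeries_mul_sq (t : R) :
    (centralSeries (t ^ 2) * (1 + PowerSeries.C t * narayanaSeries (t ^ 2))) ^ 2 *
        (1 - PowerSeries.C ((1 + t) ^ 2) * PowerSeries.X) =
      centralSeries (t ^ 2) - PowerSeries.C (t ^ 2) *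
        (centralSeries (t ^ 2) * narayanaSeries (t ^ 2) ^ 2) := by
  have hS := centralSeries_mul (t ^ 2)
  have hM := narayanaSeries_eq (t ^ 2)
  simp only [map_pow, map_add, map_one] at *
  generalize centralSeries (t ^ 2) = S at *
  generalize narayanaSeries (t ^ 2) = M at *
  generalize PowerSeries.C t = c at *
  linear_combination S * (1 + c * M) * (1 - c * M) * hS + S ^ 2 * (1 + c * M) * (2 * c) * hM

end NarayanaSeries

theorem sum_range_two_mul {M : Type*} [AddCommMonoid M] (f : ℕ → M) (n : ℕ) :
    ∑ k ∈ range (2 * n), f k = ∑ i ∈ range n, (f (2 * i) + f (2 * i + 1)) := by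
  induction n with
  | zero => simp
  | succ n ih => rw [mul_add_one, sum_range_succ, sum_range_succ, ih, sum_range_succ, add_assoc]

theorem cnarQ_two_mul_add_one (m : ℕ) :
    cnarQ (2 * m + 1) =
      shiftedBinomSum (X ^ 2 : ℚ[X]) m 0 + X * shiftedBinomSum (X ^ 2 : ℚ[X]) m 1 := by
  rw [cnarQ, cnar, if_neg (by simp), show 2 * m + 1 + 1 = 2 * (m + 1) by ring,
    sum_range_two_mul, Polynomial.map_sum, shiftedBinomSum, shiftedBinomSum, mul_sum,
    ← sum_add_distrib]
  refine sum_congr rfl fun i _ => ?_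
  rw [show (2 * m + 1 - 1) / 2 = m by lia, show (2 * m + 1) / 2 = m by lia,
    show 2 * i / 2 = i by lia, show (2 * i + 1) / 2 = i by lia,
    show (2 * i + 1 + 1) / 2 = i + 1 by lia]
  simp
  ring

theorem cnarQ_two_mul_add_two (m : ℕ) :
    cnarQ (2 * m + 2) = (1 + X) * cnarQ (2 * m + 1) := by
  have h : cnarQ (2 * m + 2) =
      ∑ i ∈ range (m + 1), (m.choose i * (m + 1).choose i : ℚ[X]) * (X ^ 2) ^ i +
      X * ∑ i ∈ range (m + 1), (m.choose i * (m + 1).choose (i + 1) : ℚ[X]) * (X ^ 2) ^ i := by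
    rw [cnarQ, cnar, if_neg (by simp), show 2 * m + 2 + 1 = 2 * (m + 1) + 1 by ring,
      sum_range_succ, sum_range_two_mul, mul_sum, ← sum_add_distrib,
      show (2 * m + 2 - 1) / 2 = m by lia, show 2 * (m + 1) / 2 = m + 1 by lia,
      show (2 * m + 2) / 2 = m + 1 by lia, Nat.choose_succ_self, Polynomial.map_add,
      Polynomial.map_sum, zero_mul, Nat.cast_zero, map_zero, zero_mul, Polynomial.map_zero,
      add_zero]
    refine sum_congr rfl fun i _ => ?_
    rw [show 2 * i / 2 = i by lia, show (2 * i + 1) / 2 = i by lia,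
      show (2 * i + 1 + 1) / 2 = i + 1 by lia]
    simp
    ring
  rw [h, sum_choose_mul_succ_choose, sum_choose_mul_succ_choose_succ, cnarQ_two_mul_add_one]
  ring

theorem narayana_number_add (m k : ℕ) :
    (m + 1).choose (k + 1) * m.choose (k + 1) / (k + 1 + 1) + m.choose k * m.choose (k + 2) =
      m.choose (k + 1) ^ 2 := by
  rcases lt_or_ge k m with hk | hk
  · obtain ⟨d, rfl⟩ := Nat.exists_eq_add_of_lt hk
    have h₁ := Nat.choose_succ_right_eq (k + d + 1) k
    have h₂ := Nat.choose_succ_right_eq (k + d + 1) (k + 1)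
    rw [show k + d + 1 - k = d + 1 by lia] at h₁
    rw [show k + d + 1 - (k + 1) = d by lia, add_assoc k 1 1] at h₂
    rw [Nat.choose_succ_succ' (k + d + 1) k]
    generalize (k + d + 1).choose k = a at *
    generalize (k + d + 1).choose (k + 1) = b at *
    generalize (k + d + 1).choose (k + 2) = c at *
    have h : (a + b) * b + (k + 1 + 1) * (a * c) = (k + 1 + 1) * b ^ 2 := by
      zify at *
      linear_combination a * h₂ - b * h₁
    rw [← Nat.add_mul_div_left _ _ (by lia : 0 < k + 1 + 1), h, Nat.mul_div_cancel_left _ (by lia)]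
  · rw [Nat.choose_eq_zero_of_lt (by lia : m < k + 1),
      Nat.choose_eq_zero_of_lt (by lia : m < k + 2)]
    simp

theorem narayanaSqQ_add_one (m : ℕ) :
    narayanaSqQ (m + 1) = shiftedBinomSum (X ^ 2 : ℚ[X]) m 0 -
      X ^ 2 * shiftedBinomSum (X ^ 2 : ℚ[X]) m 2 := by
  have h : narayanaSqQ (m + 1) = ∑ k ∈ range (m + 1),
      (((m + 1).choose k * m.choose k / (k + 1) : ℕ) : ℚ[X]) * (X ^ 2) ^ k := by
    rw [narayanaSqQ, narayana, if_neg (by simp), Polynomial.sum_comp, Polynomial.map_sum]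
    refine sum_congr rfl fun k _ => ?_
    rw [Nat.add_sub_cancel]
    generalize (m + 1).choose k * m.choose k / (k + 1) = a
    simp
  rw [h, sum_range_succ', eq_sub_iff_add_eq, shiftedBinomSum_eq_add_sum_succ _ m 0,
    shiftedBinomSum, mul_sum, sum_range_succ _ m, sum_range_succ _ m]
  simp only [Nat.choose_succ_self, Nat.choose_zero_right, pow_zero, mul_one, zero_add, add_zero,
    Nat.div_self one_pos, Nat.cast_one, Nat.cast_zero, zero_mul, mul_zero,
    Nat.choose_eq_zero_of_lt (by lia : m < m + 2)]
  rw [add_right_comm, add_comm, add_right_inj, ← sum_add_distrib]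
  refine sum_congr rfl fun k _ => ?_
  have hk := congrArg (Nat.cast : ℕ → ℚ[X]) (narayana_number_add m k)
  rw [Nat.cast_add, Nat.cast_mul, Nat.cast_pow] at hk
  linear_combination (X ^ 2) ^ (k + 1) * hk

theorem mk_cnarQ_odd :
    PowerSeries.mk (fun m => cnarQ (2 * m + 1)) = centralSeries (X ^ 2 : ℚ[X]) *
      (1 + PowerSeries.C (X : ℚ[X]) * narayanaSeries (X ^ 2 : ℚ[X])) := by
  ext1 m
  rw [PowerSeries.coeff_mk, cnarQ_two_mul_add_one, ← coeff_centralSeries_mul_pow,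
    ← coeff_centralSeries_mul_pow, ← PowerSeries.coeff_C_mul, ← map_add]
  congr 1
  ring

theorem mk_narayanaSqQ :
    PowerSeries.mk (fun m => narayanaSqQ (m + 1)) = centralSeries (X ^ 2 : ℚ[X]) -
      PowerSeries.C (X ^ 2 : ℚ[X]) *
        (centralSeries (X ^ 2 : ℚ[X]) * narayanaSeries (X ^ 2 : ℚ[X]) ^ 2) := by
  ext1 m
  rw [PowerSeries.coeff_mk, narayanaSqQ_add_one, map_sub, PowerSeries.coeff_C_mul,
    coeff_centralSeries_mul_pow, ← coeff_centralSeries_mul_pow _ m 0, pow_zero, mul_one]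

theorem mk_cnarQ_eq :
    PowerSeries.mk (fun n => cnarQ (n + 1)) =
      (1 + PowerSeries.C (1 + X : ℚ[X]) * PowerSeries.X) *
        PowerSeries.expand 2 two_ne_zero (PowerSeries.mk (fun m => cnarQ (2 * m + 1))) := by
  rw [add_mul, one_mul, mul_assoc]
  ext1 n
  rw [map_add, PowerSeries.coeff_C_mul, PowerSeries.coeff_mk]
  obtain ⟨m, rfl | rfl⟩ := n.even_or_odd'
  · rw [PowerSeries.coeff_expand_mul, PowerSeries.coeff_mk]
    cases m with
    | zero => simp
    | succ m =>
      rw [show 2 * (m + 1) = 2 * m + 1 + 1 by ring, PowerSeries.coeff_succ_X_mul,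
        PowerSeries.coeff_expand_of_not_dvd _ _ _ (by lia)]
      simp
  · rw [PowerSeries.coeff_succ_X_mul, PowerSeries.coeff_expand_mul, PowerSeries.coeff_mk,
      PowerSeries.coeff_expand_of_not_dvd _ _ _ (by lia), cnarQ_two_mul_add_two, zero_add]

theorem mk_neg_one_pow_mul_cnarQ_eq :
    PowerSeries.mk (fun n => (-1 : ℚ[X]) ^ n * cnarQ (n + 1)) =
      (1 - PowerSeries.C (1 + X : ℚ[X]) * PowerSeries.X) *
        PowerSeries.expand 2 two_ne_zero (PowerSeries.mk (fun m => cnarQ (2 * m + 1))) := by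
  rw [sub_mul, one_mul, mul_assoc]
  ext1 n
  have h := congrArg (PowerSeries.coeff n) mk_cnarQ_eq
  rw [add_mul, one_mul, mul_assoc, map_add, PowerSeries.coeff_C_mul, PowerSeries.coeff_mk] at h
  rw [map_sub, PowerSeries.coeff_C_mul, PowerSeries.coeff_mk, h]
  obtain ⟨m, rfl | rfl⟩ := n.even_or_odd'
  · cases m with
    | zero => simp
    | succ m =>
      rw [show 2 * (m + 1) = 2 * m + 1 + 1 by ring, PowerSeries.coeff_succ_X_mul,
        PowerSeries.coeff_expand_of_not_dvd _ _ (m := 2 * m + 1) _ (by lia)]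
      simp [pow_succ, pow_mul]
  · rw [PowerSeries.coeff_expand_of_not_dvd _ _ _ (by lia)]
    simp [pow_succ, pow_mul]

theorem mk_cnarQ_mul_mk_neg_one_pow_mul_cnarQ :
    PowerSeries.mk (fun n => cnarQ (n + 1))
        * PowerSeries.mk (fun n => (-1 : ℚ[X]) ^ n * cnarQ (n + 1))
      = PowerSeries.mk (fun m => if Even m then narayanaSqQ (m / 2 + 1) else 0) := by
  have h := congrArg (PowerSeries.expand 2 two_ne_zero) (centralSeries_mul_sq (X : ℚ[X]))
  rw [← mk_cnarQ_odd, ← mk_narayanaSqQ, map_mul, map_pow, map_sub, map_one, map_mul,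
    PowerSeries.expand_C, PowerSeries.expand_X, map_pow] at h
  rw [mk_cnarQ_eq, mk_neg_one_pow_mul_cnarQ_eq]
  trans PowerSeries.expand 2 two_ne_zero (PowerSeries.mk (fun m => narayanaSqQ (m + 1)))
  · rw [← h]
    ring
  · ext1 n
    simp [PowerSeries.coeff_expand, even_iff_two_dvd]

/-- In `(ℚ[t])[[z]]`, with `g(z) = ∑_{n≥0} c_{n+1}(t) z^n`, one has
`g(z)·g(-z) = ∑_{n≥0} C_{n+1}(t²) z^{2n}`; equivalently, for every `n ≥ 0`,
`∑_{j=0}^n (-1)^j c_{j+1}(t) c_{n-j+1}(t)` equals `C_{n/2+1}(t²)` for even `n` and `0` for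
odd `n`. -/
theorem cnar_gf_product :
    PowerSeries.mk (fun n => cnarQ (n + 1))
        * PowerSeries.mk (fun n => (-1 : Polynomial ℚ) ^ n * cnarQ (n + 1))
      = PowerSeries.mk (fun m => if Even m then narayanaSqQ (m / 2 + 1) else 0) ∧
      ∀ n : ℕ,
        ∑ j ∈ Finset.range (n + 1), (-1 : Polynomial ℚ) ^ j * cnarQ (j + 1) * cnarQ (n - j + 1)
          = if Even n then narayanaSqQ (n / 2 + 1) else 0 := by
  refine ⟨mk_cnarQ_mul_mk_neg_one_pow_mul_cnarQ, fun n => ?_⟩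
  have h := congrArg (PowerSeries.coeff n) mk_cnarQ_mul_mk_neg_one_pow_mul_cnarQ
  rw [mul_comm, PowerSeries.coeff_mul, Nat.sum_antidiagonal_eq_sum_range_succ_mk,
    PowerSeries.coeff_mk] at h
  simpa only [PowerSeries.coeff_mk] using h
end

section
/- Rubey's lemma: work in the polynomial ring ℤ[s,t] and take the weight sequences s_k = (-1)^k·s and t_k = t. Then the Jacobi-type array satisfies, for every n ≥ 0 and δ ∈ {0,1}, a(2n+δ, 0) = Σ_{k=0}^{n} binom(n,k)·C_k·t^k·s^{2n+δ-2k}, where C_k is the k-th Catalan number. -/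
open Polynomial Finset

/-- One step of the recursion defining `jacobiA`, as a linear map on sequences. -/
def jacobiStep {R : Type*} [CommRing R] (s t : ℕ → R) : Module.End R (ℕ → R) where
  toFun v k := (if k = 0 then 0 else v (k - 1)) + s k * v k + t k * v (k + 1)
  map_add' v w := by
    funext k
    simp only [Pi.add_apply]
    split_ifs <;> ring
  map_smul' c v := by
    funext k
    simp only [Pi.smul_apply, smul_eq_mul, RingHom.id_apply]
    split_ifs <;> ring

theorem jacobiA_eq_jacobiStep_pow {R : Type*} [CommRing R] (s t : ℕ → R) (n : ℕ) :
    jacobiA s t n = (jacobiStep s t ^ n) (jacobiA s t 0) := by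
  induction n with
  | zero => simp
  | succ n ih =>
    rw [pow_succ', Module.End.mul_apply, ← ih]
    funext k
    rw [jacobiA]
    rfl

theorem jacobiA_zero_eq {R : Type*} [CommRing R] (s s' t t' : ℕ → R) :
    jacobiA s t 0 = jacobiA s' t' 0 := by
  funext k
  simp [jacobiA]

/-- Alternating level weights square away: the diagonal part anticommutes with the
off-diagonal part. -/
theorem jacobiStep_alternating_sq {R : Type*} [CommRing R] (x t : R) :
    jacobiStep (fun k => (-1) ^ k * x) (fun _ => t) ^ 2 =
      jacobiStep 0 (fun _ => t) ^ 2 + algebraMap R _ (x ^ 2) := by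
  refine LinearMap.ext fun v => funext fun k => ?_
  have h : ((-1 : R) ^ k) ^ 2 = 1 := by rw [← pow_mul, mul_comm, pow_mul]; simp
  rw [pow_two (jacobiStep _ _), pow_two (jacobiStep _ _)]
  simp only [Module.End.mul_apply, LinearMap.add_apply, Pi.add_apply,
    Module.algebraMap_end_apply, Pi.smul_apply, smul_eq_mul, jacobiStep, LinearMap.coe_mk,
    AddHom.coe_mk, Pi.zero_apply]
  rcases k with _ | k
  · simp
    ring
  · simp only [Nat.add_sub_cancel, Nat.succ_ne_zero, if_false]
    rw [pow_succ] at h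
    simp only [pow_succ]
    linear_combination (x ^ 2 * v (k + 1)) * h

theorem jacobiA_alternating_even {R : Type*} [CommRing R] (x t : R) (n : ℕ) :
    jacobiA (fun k => (-1) ^ k * x) (fun _ => t) (2 * n) =
      ∑ j ∈ range (n + 1), (n.choose j * x ^ (2 * (n - j)) : R) •
        jacobiA 0 (fun _ => t) (2 * j) := by
  rw [jacobiA_eq_jacobiStep_pow, pow_mul, jacobiStep_alternating_sq,
    (Algebra.commute_algebraMap_right (x ^ 2) _).add_pow, LinearMap.sum_apply]
  refine sum_congr rfl fun j _ => ?_
  rw [jacobiA_eq_jacobiStep_pow 0, jacobiA_zero_eq 0 _ (fun _ => t), ← map_pow, ← pow_mul,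
    ← pow_mul, mul_assoc, Module.End.mul_apply, Module.End.mul_apply, Module.algebraMap_end_apply,
    Module.End.natCast_apply, map_smul, map_nsmul, mul_comm (n.choose j : R), mul_smul,
    Nat.cast_smul_eq_nsmul]

theorem jacobiA_zero_of_lt {R : Type*} [CommRing R] (s t : ℕ → R) {n k : ℕ} (h : n < k) :
    jacobiA s t n k = 0 := by
  induction n generalizing k with
  | zero => simp [jacobiA, h.ne']
  | succ n ih =>
    rw [jacobiA, ih (by omega), ih (by omega), ih (by omega)]
    simp

theorem jacobiA_zero_of_odd {R : Type*} [CommRing R] (t : ℕ → R) {n k : ℕ} (h : Odd (n + k)) :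
    jacobiA 0 t n k = 0 := by
  induction n generalizing k with
  | zero =>
    have : k ≠ 0 := by rintro rfl; simp at h
    simp [jacobiA, this]
  | succ n ih =>
    have h₁ : jacobiA 0 t n (k + 1) = 0 := ih (by grind)
    have h₂ : k ≠ 0 → jacobiA 0 t n (k - 1) = 0 := fun hk => ih (by grind)
    rw [jacobiA, h₁]
    split_ifs with hk
    · simp
    · simp [h₂ hk]

/-- Ballot numbers count the weighted Dyck prefixes. -/
theorem jacobiA_zero_ballot {R : Type*} [CommRing R] (t : R) (m k : ℕ) :
    jacobiA 0 (fun _ => t) (2 * m + k) k =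
      t ^ m * ((2 * m + k).choose m - (2 * m + k).choose (m + k + 1)) := by
  generalize hN : 2 * m + k = N
  induction N generalizing m k with
  | zero =>
    obtain ⟨rfl, rfl⟩ : m = 0 ∧ k = 0 := by omega
    simp [jacobiA]
  | succ N ih =>
    rw [jacobiA]
    rcases m with _ | m
    · obtain rfl : k = N + 1 := by omega
      have := ih 0 N (by omega)
      rw [jacobiA_zero_of_lt _ _ (by omega : N < N + 1 + 1)]
      simp_all
    · have h₁ := ih m (k + 1) (by omega)
      rcases k with _ | k
      · obtain rfl : N = 2 * m + 1 := by omega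
        simp only [h₁, Nat.choose_succ_succ]
        push_cast
        simp
        ring_nf
      · have h₂ := ih (m + 1) k (by omega)
        simp only [Nat.add_sub_cancel, Nat.succ_ne_zero, if_false, h₁, h₂,
          show m + 1 + (k + 1) + 1 = (m + k + 2) + 1 by ring,
          show m + (k + 1 + 1) + 1 = m + k + 2 + 1 by ring,
          show m + 1 + k + 1 = m + k + 2 by ring, Nat.choose_succ_succ N]
        push_cast
        simp
        ring

theorem catalan_add_choose (m : ℕ) :
    catalan m + (2 * m).choose (m + 1) = (2 * m).choose m := by
  have h₁ := succ_mul_catalan_eq_centralBinom m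
  have h₂ := Nat.choose_succ_right_eq (2 * m) m
  rw [Nat.centralBinom_eq_two_mul_choose] at h₁
  rw [show 2 * m - m = m by omega] at h₂
  nlinarith

theorem jacobiA_zero_catalan {R : Type*} [CommRing R] (t : R) (m : ℕ) :
    jacobiA 0 (fun _ => t) (2 * m) 0 = catalan m * t ^ m := by
  have h := jacobiA_zero_ballot t m 0
  rw [add_zero, add_zero, ← catalan_add_choose] at h
  rw [h]
  push_cast
  ring

theorem jacobiA_alternating_even_zero {R : Type*} [CommRing R] (x t : R) (n : ℕ) :
    jacobiA (fun k => (-1) ^ k * x) (fun _ => t) (2 * n) 0 =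
      ∑ j ∈ range (n + 1), n.choose j * catalan j * t ^ j * x ^ (2 * (n - j)) := by
  simp only [jacobiA_alternating_even, Finset.sum_apply, Pi.smul_apply, smul_eq_mul,
    jacobiA_zero_catalan]
  exact sum_congr rfl fun j _ => by ring

theorem jacobiA_alternating_odd_zero {R : Type*} [CommRing R] (x t : R) (n : ℕ) :
    jacobiA (fun k => (-1) ^ k * x) (fun _ => t) (2 * n + 1) 0 =
      x * jacobiA (fun k => (-1) ^ k * x) (fun _ => t) (2 * n) 0 := by
  have h : jacobiA (fun k => (-1) ^ k * x) (fun _ => t) (2 * n) 1 = 0 := by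
    rw [jacobiA_alternating_even, Finset.sum_apply]
    refine sum_eq_zero fun j _ => ?_
    rw [Pi.smul_apply, jacobiA_zero_of_odd _ (by simp), smul_zero]
  rw [jacobiA]
  simp [h]

/-- Rubey's lemma: in `ℤ[s,t]` with weights `s_k = (-1)^k s`, `t_k = t`, the Jacobi-type
array satisfies, for `n ≥ 0` and `δ ∈ {0,1}`,
`a(2n+δ,0) = ∑_{k=0}^n binom(n,k) C_k t^k s^{2n+δ-2k}` (`C_k` the Catalan numbers). -/
theorem rubey_lemma (n δ : ℕ) (hδ : δ = 0 ∨ δ = 1) :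
    jacobiA (fun k => (-1 : MvPolynomial (Fin 2) ℤ) ^ k * MvPolynomial.X 0)
        (fun _ => MvPolynomial.X 1) (2 * n + δ) 0
      = ∑ k ∈ Finset.range (n + 1),
          (MvPolynomial.C ((n.choose k * catalan k : ℕ) : ℤ) : MvPolynomial (Fin 2) ℤ)
            * MvPolynomial.X 1 ^ k * MvPolynomial.X 0 ^ (2 * n + δ - 2 * k) := by
  rcases hδ with rfl | rfl
  · rw [add_zero, jacobiA_alternating_even_zero]
    refine sum_congr rfl fun k _ => ?_
    rw [Nat.mul_sub]
    simp
  · rw [jacobiA_alternating_odd_zero, jacobiA_alternating_even_zero, mul_sum]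
    refine sum_congr rfl fun k hk => ?_
    have hk' : k ≤ n := Nat.lt_succ_iff.mp (mem_range.mp hk)
    rw [show 2 * n + 1 - 2 * k = 2 * (n - k) + 1 by omega, pow_succ]
    simp
    ring
end

section
/- Theorem 3: with the weight sequences s_k = 0 for all k, t_{2k} = (-1)^k and t_{2k+1} = (-1)^k·t (in ℤ[t]), the Jacobi-type array satisfies a(2n,0) = c_n(t) and a(2n+1,0) = 0 for all n ≥ 0; i.e., the generating function Σ_{n≥0} c_n(t) z^{2n} has the Jacobi continued fraction expansion with s_n = 0, t_{2n} = (-1)^n, t_{2n+1} = (-1)^n t. In particular, with t = 1 the weights are s_k = 0, t_k = (-1)^{k(k-1)/2}, and a(2n,0) = binom(n, ⌊n/2⌋). -/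
open Polynomial Finset

section JacobiArray

variable {R : Type*} [CommRing R]

lemma jacobiA_zero_weight_succ_zero (w : ℕ → R) (n : ℕ) :
    jacobiA (fun _ => 0) w (n + 1) 0 = w 0 * jacobiA (fun _ => 0) w n 1 := by
  simp [jacobiA]

lemma jacobiA_zero_weight_succ_succ (w : ℕ → R) (n k : ℕ) :
    jacobiA (fun _ => 0) w (n + 1) (k + 1) =
      jacobiA (fun _ => 0) w n k + w (k + 1) * jacobiA (fun _ => 0) w n (k + 2) := by
  simp [jacobiA]

lemma jacobiA_zero_weight_of_odd (w : ℕ → R) (n k : ℕ) (h : Odd (n + k)) :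
    jacobiA (fun _ => 0) w n k = 0 := by
  induction n generalizing k with
  | zero =>
    have hk : k ≠ 0 := by rintro rfl; simp at h
    simp [jacobiA, hk]
  | succ n ih =>
    cases k with
    | zero => rw [jacobiA_zero_weight_succ_zero, ih 1 (by simpa using h), mul_zero]
    | succ k =>
      rw [jacobiA_zero_weight_succ_succ, ih k (by grind), ih (k + 2) (by grind)]
      simp

/-- Weights of period four: `1, t, -1, -t, 1, t, -1, -t, …`. -/
structure IsSignedWeight (t : R) (w : ℕ → R) : Prop where
  zero : ∀ j, w (4 * j) = 1
  one : ∀ j, w (4 * j + 1) = t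
  two : ∀ j, w (4 * j + 2) = -1
  three : ∀ j, w (4 * j + 3) = -t

/-- The recurrence obeyed by the common value of the entries in columns `4 * j` and `4 * j + 2`
of row `4 * m + 2`, for weights of period four `1, t, -1, -t`. -/
structure IsSignedArray (t : R) (f : ℕ → ℕ → R) : Prop where
  row_zero : ∀ j, f 0 j = if j = 0 then 1 else 0
  succ_zero : ∀ m, f (m + 1) 0 = (1 + t + t ^ 2) * f m 0 + t ^ 2 * f m 1
  succ_succ : ∀ m j,
    f (m + 1) (j + 1) = f m j + (1 + t ^ 2) * f m (j + 1) + t ^ 2 * f m (j + 2)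

namespace IsSignedWeight

variable {t : R} {w : ℕ → R}

lemma add_two_zero (hw : IsSignedWeight t w) (n : ℕ) :
    jacobiA (fun _ => 0) w (n + 2) 0 =
      jacobiA (fun _ => 0) w n 0 + t * jacobiA (fun _ => 0) w n 2 := by
  have h0 := hw.zero 0
  have h1 := hw.one 0
  simp only [mul_zero, zero_add] at h0 h1
  rw [jacobiA_zero_weight_succ_zero, jacobiA_zero_weight_succ_succ, h0, h1, one_mul]

lemma add_two_four_mul_succ (hw : IsSignedWeight t w) (n j : ℕ) :
    jacobiA (fun _ => 0) w (n + 2) (4 * (j + 1)) =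
      jacobiA (fun _ => 0) w n (4 * j + 2) + (1 - t) * jacobiA (fun _ => 0) w n (4 * (j + 1))
        + t * jacobiA (fun _ => 0) w n (4 * (j + 1) + 2) := by
  rw [show 4 * (j + 1) = 4 * j + 3 + 1 by ring, jacobiA_zero_weight_succ_succ,
    jacobiA_zero_weight_succ_succ, jacobiA_zero_weight_succ_succ _ n (4 * j + 3 + 1), hw.three,
    show 4 * j + 3 + 1 = 4 * (j + 1) by ring, hw.zero, hw.one]
  ring

lemma add_two_four_mul_add_two (hw : IsSignedWeight t w) (n j : ℕ) :
    jacobiA (fun _ => 0) w (n + 2) (4 * j + 2) =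
      jacobiA (fun _ => 0) w n (4 * j) + (t - 1) * jacobiA (fun _ => 0) w n (4 * j + 2)
        + t * jacobiA (fun _ => 0) w n (4 * (j + 1)) := by
  rw [show 4 * j + 2 = 4 * j + 1 + 1 by ring, jacobiA_zero_weight_succ_succ,
    jacobiA_zero_weight_succ_succ, jacobiA_zero_weight_succ_succ _ n (4 * j + 1 + 1), hw.one,
    hw.two, hw.three, show 4 * j + 1 + 1 + 2 = 4 * (j + 1) by ring]
  ring

variable {f : ℕ → ℕ → R}

lemma jacobiA_four_mul_add_two (hw : IsSignedWeight t w) (hf : IsSignedArray t f) (m j : ℕ) :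
    jacobiA (fun _ => 0) w (4 * m + 2) (4 * j) = f m j ∧
      jacobiA (fun _ => 0) w (4 * m + 2) (4 * j + 2) = f m j := by
  induction m generalizing j with
  | zero =>
    rw [mul_zero, hw.add_two_four_mul_add_two, hf.row_zero]
    cases j with
    | zero => rw [mul_zero, hw.add_two_zero]; simp [jacobiA]
    | succ j => rw [hw.add_two_four_mul_succ]; simp [jacobiA]
  | succ m ih =>
    have hA0 : jacobiA (fun _ => 0) w (4 * m + 2 + 2) 0 = f m 0 + t * f m 0 := by
      have h := ih 0
      simp only [mul_zero, zero_add] at h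
      rw [hw.add_two_zero, h.1, h.2]
    have hA (j : ℕ) : jacobiA (fun _ => 0) w (4 * m + 2 + 2) (4 * (j + 1)) =
        f m j + f m (j + 1) := by
      rw [hw.add_two_four_mul_succ, (ih j).2, (ih (j + 1)).1, (ih (j + 1)).2]
      ring
    have hB (j : ℕ) : jacobiA (fun _ => 0) w (4 * m + 2 + 2) (4 * j + 2) =
        t * (f m j + f m (j + 1)) := by
      rw [hw.add_two_four_mul_add_two, (ih j).1, (ih j).2, (ih (j + 1)).1]
      ring
    rw [show 4 * (m + 1) + 2 = 4 * m + 2 + 2 + 2 by ring,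
      hw.add_two_four_mul_add_two (4 * m + 2 + 2), hB, hA]
    cases j with
    | zero =>
      have hB0 := hB 0
      simp only [mul_zero, zero_add] at hB0 ⊢
      rw [hw.add_two_zero, hA0, hB0, hf.succ_zero]
      constructor <;> ring
    | succ j =>
      rw [hw.add_two_four_mul_succ (4 * m + 2 + 2), hA, hB, hB, hf.succ_succ]
      constructor <;> ring

lemma jacobiA_four_mul_add_two_zero (hw : IsSignedWeight t w) (hf : IsSignedArray t f) (m : ℕ) :
    jacobiA (fun _ => 0) w (4 * m + 2) 0 = f m 0 :=
  (hw.jacobiA_four_mul_add_two hf m 0).1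

lemma jacobiA_four_mul_add_four_zero (hw : IsSignedWeight t w) (hf : IsSignedArray t f) (m : ℕ) :
    jacobiA (fun _ => 0) w (4 * m + 4) 0 = (1 + t) * f m 0 := by
  have h := hw.jacobiA_four_mul_add_two hf m 0
  simp only [mul_zero, zero_add] at h
  rw [hw.add_two_zero, h.1, h.2]
  ring

end IsSignedWeight

lemma isSignedWeight_ite (t : R) :
    IsSignedWeight t (fun k => if Even k then (-1) ^ (k / 2) else (-1) ^ (k / 2) * t) where
  zero j := by
    rw [if_pos (by grind), show 4 * j / 2 = 2 * j by omega]
    simp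
  one j := by
    rw [if_neg (by grind), show (4 * j + 1) / 2 = 2 * j by omega]
    simp
  two j := by
    rw [if_pos (by grind), show (4 * j + 2) / 2 = 2 * j + 1 by omega]
    simp [pow_succ]
  three j := by
    rw [if_neg (by grind), show (4 * j + 3) / 2 = 2 * j + 1 by omega]
    simp [pow_succ]

lemma neg_one_pow_mul_pred_div_two (k : ℕ) :
    (-1 : R) ^ (k * (k - 1) / 2) = if Even k then (-1) ^ (k / 2) else (-1) ^ (k / 2) * 1 := by
  obtain ⟨j, rfl | rfl⟩ := Nat.even_or_odd' k
  · rcases j with _ | j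
    · simp
    · rw [show 2 * (j + 1) - 1 = 2 * j + 1 by omega, mul_assoc, Nat.mul_div_cancel_left _ two_pos,
        Nat.mul_div_cancel_left _ two_pos, mul_comm, pow_mul, Odd.neg_one_pow ⟨j, rfl⟩]
      simp
  · rw [add_tsub_cancel_right, show (2 * j + 1) * (2 * j) = 2 * ((2 * j + 1) * j) by ring,
      Nat.mul_div_cancel_left _ two_pos, pow_mul, Odd.neg_one_pow ⟨j, rfl⟩,
      show (2 * j + 1) / 2 = j by omega]
    simp

end JacobiArray

/-- The polynomial `∑ k, binom(m, ⌊k/2⌋) * binom(m, ⌊(k+1)/2⌋ + j) * t^k`. -/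
noncomputable def shiftedCnar (m j : ℕ) : Polynomial ℤ :=
  ∑ k ∈ Finset.range (2 * m + 2),
    Polynomial.C ((m.choose (k / 2) * m.choose ((k + 1) / 2 + j) : ℕ) : ℤ) * Polynomial.X ^ k

lemma coeff_shiftedCnar (m j k : ℕ) :
    (shiftedCnar m j).coeff k = (m.choose (k / 2) * m.choose ((k + 1) / 2 + j) : ℕ) := by
  simp only [shiftedCnar, finsetSum_coeff, coeff_C_mul_X_pow, Finset.sum_ite_eq, Finset.mem_range]
  split_ifs with h
  · rfl
  · rw [Nat.choose_eq_zero_of_lt (by omega : m < k / 2)]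
    simp

lemma isSignedArray_shiftedCnar : IsSignedArray (X : ℤ[X]) shiftedCnar where
  row_zero j := by
    ext k
    rw [coeff_shiftedCnar]
    rcases k with _ | k
    · cases j <;> simp
    · rw [show (k + 1 + 1) / 2 + j = (k / 2 + j) + 1 by omega]
      split_ifs <;> simp [coeff_one]
  succ_zero m := by
    have hring : (1 + X + X ^ 2) * shiftedCnar m 0 + X ^ 2 * shiftedCnar m 1 =
        shiftedCnar m 0 + shiftedCnar m 0 * X
          + (shiftedCnar m 0 + shiftedCnar m 1) * X ^ 2 := by ring
    rw [hring]
    ext k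
    rcases k with _ | _ | k
    · simp [coeff_shiftedCnar, coeff_X_pow]
    · simp [coeff_shiftedCnar, coeff_mul_X_pow']
    · simp only [coeff_add, coeff_mul_X_pow, coeff_mul_X, coeff_shiftedCnar]
      obtain ⟨i, rfl | rfl⟩ := Nat.even_or_odd' k
      · rw [show (2 * i + 1 + 1) / 2 = i + 1 by omega, show (2 * i + 1 + 1 + 1) / 2 = i + 1 by omega,
          show (2 * i + 1) / 2 = i by omega, show 2 * i / 2 = i by omega]
        simp only [add_zero, Nat.choose_succ_succ']
        push_cast
        ring
      · rw [show (2 * i + 1 + 1 + 1) / 2 = i + 1 by omega,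
          show (2 * i + 1 + 1 + 1 + 1) / 2 = i + 1 + 1 by omega,
          show (2 * i + 1 + 1) / 2 = i + 1 by omega, show (2 * i + 1) / 2 = i by omega]
        simp only [add_zero, Nat.choose_succ_succ']
        push_cast
        ring
  succ_succ m j := by
    have hring : shiftedCnar m j + (1 + X ^ 2) * shiftedCnar m (j + 1)
          + X ^ 2 * shiftedCnar m (j + 2) =
        shiftedCnar m j + shiftedCnar m (j + 1)
          + (shiftedCnar m (j + 1) + shiftedCnar m (j + 2)) * X ^ 2 := by ring
    rw [hring]
    ext k
    rcases k with _ | _ | k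
    · simp [coeff_shiftedCnar, coeff_X_pow, Nat.choose_succ_succ']
    · simp [coeff_shiftedCnar, coeff_mul_X_pow', Nat.choose_succ_succ', ← add_assoc,
        add_comm 1 j]
    · simp only [coeff_add, coeff_mul_X_pow, coeff_shiftedCnar]
      rw [show (k + 1 + 1) / 2 = k / 2 + 1 by omega,
        show (k + 1 + 1 + 1) / 2 = (k + 1) / 2 + 1 by omega,
        show (k + 1) / 2 + 1 + (j + 1) = (k + 1) / 2 + j + 1 + 1 by ring,
        show (k + 1) / 2 + 1 + j = (k + 1) / 2 + j + 1 by ring,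
        show (k + 1) / 2 + (j + 1) = (k + 1) / 2 + j + 1 by ring,
        show (k + 1) / 2 + (j + 2) = (k + 1) / 2 + j + 1 + 1 by ring]
      simp only [Nat.choose_succ_succ']
      push_cast
      ring

lemma cnar_two_mul_add_one (m : ℕ) : cnar (2 * m + 1) = shiftedCnar m 0 := by
  simp only [cnar, shiftedCnar, Nat.succ_ne_zero, if_false]
  rw [show (2 * m + 1 - 1) / 2 = m by omega, show (2 * m + 1) / 2 = m by omega]
  rfl

lemma cnar_two_mul_add_two (m : ℕ) : cnar (2 * m + 2) = (1 + X) * shiftedCnar m 0 := by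
  have hcoeff (k : ℕ) : (cnar (2 * m + 2)).coeff k =
      (m.choose (k / 2) * (m + 1).choose ((k + 1) / 2) : ℕ) := by
    simp only [cnar, Nat.succ_ne_zero, if_false, finsetSum_coeff, coeff_C_mul_X_pow,
      Finset.sum_ite_eq, Finset.mem_range]
    rw [show (2 * m + 2 - 1) / 2 = m by omega, show (2 * m + 2) / 2 = m + 1 by omega]
    split_ifs with h
    · rfl
    · rw [Nat.choose_eq_zero_of_lt (by omega : m < k / 2)]
      simp
  rw [show (1 + X) * shiftedCnar m 0 = shiftedCnar m 0 + shiftedCnar m 0 * X by ring]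
  ext k
  rcases k with _ | k
  · simp [hcoeff, coeff_shiftedCnar]
  · simp only [coeff_add, coeff_mul_X, hcoeff, coeff_shiftedCnar, add_zero]
    obtain ⟨i, rfl | rfl⟩ := Nat.even_or_odd' k
    · rw [show (2 * i + 1) / 2 = i by omega, show (2 * i + 1 + 1) / 2 = i + 1 by omega,
        show 2 * i / 2 = i by omega, Nat.choose_succ_succ']
      push_cast
      ring
    · rw [show (2 * i + 1 + 1 + 1) / 2 = i + 1 by omega, show (2 * i + 1 + 1) / 2 = i + 1 by omega,
        show (2 * i + 1) / 2 = i by omega, Nat.choose_succ_succ']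
      push_cast
      ring

lemma isSignedArray_choose :
    IsSignedArray (1 : ℤ) (fun m j => ((2 * m + 1).choose (m + 1 + j) : ℤ)) where
  row_zero j := by cases j <;> simp [Nat.choose_eq_zero_of_lt, add_comm]
  succ_zero m := by
    have hsymm : (2 * m + 1).choose m = (2 * m + 1).choose (m + 1) :=
      Nat.choose_symm_half m |>.symm
    simp only [add_zero, show 2 * (m + 1) + 1 = 2 * m + 1 + 1 + 1 by ring, Nat.choose_succ_succ' (2 * m + 1 + 1),
      Nat.choose_succ_succ' (2 * m + 1), hsymm]
    push_cast
    ring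
  succ_succ m j := by
    simp only [show 2 * (m + 1) + 1 = 2 * m + 1 + 1 + 1 by ring,
      show m + 1 + 1 + (j + 1) = m + 1 + j + 1 + 1 by ring,
      show m + 1 + (j + 1) = m + 1 + j + 1 by ring,
      show m + 1 + (j + 2) = m + 1 + j + 1 + 1 by ring]
    rw [Nat.choose_succ_succ' (2 * m + 1 + 1), Nat.choose_succ_succ' (2 * m + 1),
      Nat.choose_succ_succ' (2 * m + 1)]
    push_cast
    ring

/-- Theorem 3: with weights `s_k = 0`, `t_{2k} = (-1)^k`, `t_{2k+1} = (-1)^k t` in `ℤ[t]`,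
the Jacobi-type array satisfies `a(2n,0) = c_n(t)` and `a(2n+1,0) = 0`. In particular, at
`t = 1` (over `ℤ`) the weights are `s_k = 0`, `t_k = (-1)^{k(k-1)/2}` and
`a(2n,0) = binom(n,⌊n/2⌋)`. -/
theorem jacobi_cnar_even (n : ℕ) :
    (jacobiA (fun _ => (0 : Polynomial ℤ))
        (fun k => if Even k then ((-1 : Polynomial ℤ)) ^ (k / 2)
          else (-1) ^ (k / 2) * Polynomial.X) (2 * n) 0 = cnar n ∧
      jacobiA (fun _ => (0 : Polynomial ℤ))
        (fun k => if Even k then ((-1 : Polynomial ℤ)) ^ (k / 2)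
          else (-1) ^ (k / 2) * Polynomial.X) (2 * n + 1) 0 = 0) ∧
      jacobiA (fun _ => (0 : ℤ)) (fun k => (-1 : ℤ) ^ (k * (k - 1) / 2)) (2 * n) 0
        = (n.choose (n / 2) : ℤ) := by
  have hw := isSignedWeight_ite (X : ℤ[X])
  have hw' : IsSignedWeight (1 : ℤ) (fun k => (-1 : ℤ) ^ (k * (k - 1) / 2)) := by
    simpa only [neg_one_pow_mul_pred_div_two] using isSignedWeight_ite (1 : ℤ)
  refine ⟨⟨?_, jacobiA_zero_weight_of_odd _ _ _ ⟨n, rfl⟩⟩, ?_⟩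
  · rcases n with _ | n
    · simp [jacobiA, cnar]
    obtain ⟨m, rfl | rfl⟩ := Nat.even_or_odd' n
    · rw [cnar_two_mul_add_one, show 2 * (2 * m + 1) = 4 * m + 2 by ring,
        hw.jacobiA_four_mul_add_two_zero isSignedArray_shiftedCnar]
    · rw [cnar_two_mul_add_two, show 2 * (2 * m + 1 + 1) = 4 * m + 4 by ring,
        hw.jacobiA_four_mul_add_four_zero isSignedArray_shiftedCnar]
  · rcases n with _ | n
    · simp [jacobiA]
    obtain ⟨m, rfl | rfl⟩ := Nat.even_or_odd' n
    · rw [show 2 * (2 * m + 1) = 4 * m + 2 by ring,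
        hw'.jacobiA_four_mul_add_two_zero isSignedArray_choose,
        show (2 * m + 1) / 2 = m by omega, add_zero, Nat.choose_symm_half]
    · rw [show 2 * (2 * m + 1 + 1) = 4 * m + 4 by ring,
        hw'.jacobiA_four_mul_add_four_zero isSignedArray_choose,
        show (2 * m + 1 + 1) / 2 = m + 1 by omega, add_zero,
        Nat.choose_succ_succ' (2 * m + 1), ← Nat.choose_symm_half m]
      push_cast
      ring
end
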